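/- Let N ∈ ℕ be fixed. For any M₀ > 0 there exist t₀ > 0 and constants c, C > 0 such that for all φ ∈ (0,π) and 0 < t ≤ t₀ satisfying (π−φ)/t ≤ M₀: c·W_t(φ)·t^{-2N} ≤ ((−D)^N θ_t)(φ) ≤ C·W_t(φ)·t^{-2N}. -/

import Mathlib

/-- The one-dimensional Gauss-Weierstrass kernel `W_t(x) = (4*pi*t)^(-1/2) exp(-x^2/(4t))`. -/
noncomputable def W (t x : ℝ) : ℝ :=
  (1 / Real.sqrt (4 * Real.pi * t)) * Real.exp (-x ^ 2 / (4 * t))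

/-- The 2*pi-periodization of `W t` (heat kernel of the circle). -/
noncomputable def theta (t φ : ℝ) : ℝ := ∑' n : ℤ, W t (φ + 2 * Real.pi * n)

/-- The operator `f ↦ -(1/sin φ) * f'`. -/
noncomputable def negD (f : ℝ → ℝ) : ℝ → ℝ := fun φ => -(deriv f φ / Real.sin φ)


/-- `derivs a b n j` is the `j`-th derivative of `∏ k < n, (a k + b k * x)`. -/
noncomputable def derivs {K : Type*} [Field K] (a b : ℕ → K) : ℕ → ℕ → K → K
  | 0, 0, _ => 1
  | 0, _ + 1, _ => 0
  | n + 1, j, x => derivs a b n j x * (a n + b n * x) + j * derivs a b n (j - 1) x * b n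

lemma derivs_zero {K : Type*} [Field K] (a b : ℕ → K) (n : ℕ) (x : K) :
    derivs a b n 0 x = ∏ k ∈ Finset.range n, (a k + b k * x) := by
  induction n with
  | zero => simp [derivs]
  | succ n ih => simp [derivs, ih, Finset.prod_range_succ]

lemma hasDerivAt_derivs {K : Type*} [NontriviallyNormedField K] (a b : ℕ → K) (n : ℕ) :
    ∀ (j : ℕ) (x : K), HasDerivAt (derivs a b n j) (derivs a b n (j + 1) x) x := by
  induction n with
  | zero =>
    intro j x
    cases j with
    | zero => exact hasDerivAt_const x (1 : K)
    | succ j => exact hasDerivAt_const x (0 : K)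
  | succ n ih =>
    intro j x
    have hl : HasDerivAt (fun x => a n + b n * x) (b n) x := by
      simpa using ((hasDerivAt_id x).const_mul (b n)).const_add (a n)
    have h1 := (ih j x).mul hl
    have h2 : HasDerivAt (fun x => (j : K) * derivs a b n (j - 1) x * b n)
        ((j : K) * derivs a b n j x * b n) x := by
      cases j with
      | zero => simpa using hasDerivAt_const x (0 : K)
      | succ j => exact ((ih j x).const_mul _).mul_const _
    have h3 := h1.add h2
    have e : derivs a b (n + 1) (j + 1) x =
        derivs a b n (j + 1) x * (a n + b n * x) + derivs a b n j x * b n +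
          (j : K) * derivs a b n j x * b n := by
      simp only [derivs, Nat.add_sub_cancel]; push_cast; ring
    rw [e]
    exact h3

lemma derivs_ofReal (a b : ℕ → ℝ) (n : ℕ) : ∀ (j : ℕ) (x : ℝ),
    derivs (fun k => (a k : ℂ)) (fun k => (b k : ℂ)) n j (x : ℂ) = ((derivs a b n j x : ℝ) : ℂ) := by
  induction n with
  | zero => intro j x; cases j <;> simp [derivs]
  | succ n ih => intro j x; simp [derivs, ih]

section bounds
variable (a b : ℕ → ℝ) (x : ℝ)

lemma derivs_nonneg (hb : ∀ k, 0 ≤ b k) (hl : ∀ k, 0 < a k + b k * x) (n : ℕ) :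
    ∀ j : ℕ, 0 ≤ derivs a b n j x := by
  induction n with
  | zero => intro j; cases j <;> simp [derivs]
  | succ n ih =>
    intro j
    simp only [derivs]
    have := ih j; have := ih (j-1); have := hb n; have := hl n
    positivity

lemma derivs_lower (hb : ∀ k, 0 ≤ b k) (hl : ∀ k, 0 < a k + b k * x) (m : ℝ) (hm : 0 ≤ m)
    (N : ℕ) (hr : ∀ k < N, m * (a k + b k * x) ≤ b k) (n : ℕ) :
    ∀ j : ℕ, j ≤ n → j ≤ N → m ^ j * derivs a b n 0 x ≤ derivs a b n j x := by
  induction n with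
  | zero => intro j hj _; obtain rfl : j = 0 := by omega
            simp
  | succ n ih =>
    intro j hj hjN
    have h0 := derivs_nonneg a b x hb hl n
    have hln := hl n
    have hbn := hb n
    have e0 : derivs a b (n+1) 0 x = derivs a b n 0 x * (a n + b n * x) := by simp [derivs]
    rw [e0]
    simp only [derivs]
    rcases Nat.lt_or_ge n j with h | h
    · obtain rfl : j = n + 1 := by omega
      have h1 := ih n le_rfl (by omega)
      have h2 := hr n (by omega)
      have h3 : 0 ≤ derivs a b n (n+1) x * (a n + b n * x) := mul_nonneg (h0 _) hln.le
      have h4 : m ^ n * derivs a b n 0 x * (m * (a n + b n * x)) ≤ derivs a b n n x * b n :=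
        mul_le_mul h1 h2 (by positivity) (h0 _)
      have h5 : derivs a b n n x * b n ≤ ((n+1 : ℕ) : ℝ) * derivs a b n n x * b n := by
        have : 0 ≤ (n : ℝ) * (derivs a b n n x * b n) := by
          have := h0 n
          positivity
        push_cast; linarith
      simp only [Nat.add_sub_cancel]
      calc _ = m ^ n * derivs a b n 0 x * (m * (a n + b n * x)) := by ring
        _ ≤ _ := by linarith
    · have h1 := ih j h hjN
      have h3 : 0 ≤ (j : ℝ) * derivs a b n (j-1) x * b n := by
        have := h0 (j-1)
        positivity
      calc _ = m ^ j * derivs a b n 0 x * (a n + b n * x) := by ring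
        _ ≤ derivs a b n j x * (a n + b n * x) := by gcongr
        _ ≤ _ := by linarith

lemma add_pow_ge (S r : ℝ) (hS : 0 ≤ S) (hr : 0 ≤ r) (j : ℕ) :
    S ^ j + j * S ^ (j - 1) * r ≤ (S + r) ^ j := by
  induction j with
  | zero => simp
  | succ j ih =>
    have h0 : (j : ℝ) * S ^ (j - 1) * S = j * S ^ j := by
      cases j with
      | zero => simp
      | succ j => simp [pow_succ]; ring
    have h : 0 ≤ (j : ℝ) * S ^ (j - 1) * r * r := by positivity
    calc _ ≤ (S ^ j + j * S ^ (j - 1) * r) * (S + r) := by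
            simp only [Nat.add_sub_cancel]; push_cast
            have : (S ^ j + j * S ^ (j - 1) * r) * (S + r) =
              S ^ (j+1) + S ^ j * r + (j * S ^ (j - 1) * S) * r + j * S ^ (j - 1) * r * r := by ring
            rw [this, h0]; nlinarith
      _ ≤ (S+r)^j * (S+r) := by gcongr
      _ = _ := by ring

lemma derivs_upper (hb : ∀ k, 0 ≤ b k) (hl : ∀ k, 0 < a k + b k * x) (r : ℕ → ℝ)
    (hr0 : ∀ k, 0 ≤ r k)
    (hr : ∀ k, b k ≤ r k * (a k + b k * x)) (n : ℕ) :
    ∀ j : ℕ, derivs a b n j x ≤ (∑ k ∈ Finset.range n, r k) ^ j * derivs a b n 0 x := by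
  induction n with
  | zero => intro j; cases j <;> simp [derivs]
  | succ n ih =>
    intro j
    have h0 := derivs_nonneg a b x hb hl n
    have hln := hl n
    have hbn := hb n
    have h00 := h0 0
    have e0 : derivs a b (n+1) 0 x = derivs a b n 0 x * (a n + b n * x) := by simp [derivs]
    rw [e0, Finset.sum_range_succ]
    set S := ∑ k ∈ Finset.range n, r k with hS
    have hS0 : 0 ≤ S := Finset.sum_nonneg fun k _ => hr0 k
    simp only [derivs]
    have h1 := ih j
    have h2 := ih (j-1)
    have h3 : derivs a b n (j-1) x * b n ≤
        (S ^ (j-1) * derivs a b n 0 x) * (r n * (a n + b n * x)) :=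
      mul_le_mul h2 (hr n) hbn (by positivity)
    calc _ ≤ (S ^ j * derivs a b n 0 x) * (a n + b n * x) +
          j * ((S ^ (j-1) * derivs a b n 0 x) * (r n * (a n + b n * x))) := by
            rw [mul_assoc (j : ℝ)]; gcongr
      _ = (S ^ j + j * S ^ (j - 1) * r n) * (derivs a b n 0 x * (a n + b n * x)) := by ring
      _ ≤ _ := by
        have := add_pow_ge S (r n) hS0 (hr0 n) j
        gcongr
end bounds

/-! limit -/
open Filter Topology in
lemma exists_limit (a b : ℕ → ℝ) (ha : Summable fun k => |a k - 1|) (hb : Summable fun k => |b k|) :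
    ∃ G : ℕ → ℝ → ℝ, (∀ j x, HasDerivAt (G j) (G (j + 1) x) x) ∧
      ∀ j x, Tendsto (fun n => derivs a b n j x) atTop (𝓝 (G j x)) := by
  let F : ℕ → ℕ → ℂ → ℂ := fun j n => derivs (fun k => (a k : ℂ)) (fun k => (b k : ℂ)) n j
  let g : ℂ → ℂ := fun z => ∏' k, (1 + ((a k : ℂ) - 1 + b k * z))
  have h0 : TendstoLocallyUniformlyOn (F 0) g atTop Set.univ := by
    have : HasProdLocallyUniformlyOn (fun k (z : ℂ) => 1 + ((a k : ℂ) - 1 + b k * z)) g Set.univ := by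
      apply hasProdLocallyUniformlyOn_of_forall_compact isOpen_univ
      intro K _ hK
      obtain ⟨R, hR⟩ := hK.isBounded.exists_norm_le
      refine Summable.hasProdUniformlyOn_nat_one_add (u := fun k => |a k - 1| + |b k| * R) hK
        (ha.add (hb.mul_right R)) (Eventually.of_forall fun n z hz => ?_) (fun n => by fun_prop)
      refine (norm_add_le _ _).trans ?_
      rw [norm_mul]
      have e1 : ‖(a n : ℂ) - 1‖ = |a n - 1| := by
        rw [← Complex.ofReal_one, ← Complex.ofReal_sub, Complex.norm_real, Real.norm_eq_abs]
      rw [e1, Complex.norm_real, Real.norm_eq_abs]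
      have := hR z hz
      gcongr
    convert this.tendstoLocallyUniformlyOn_finsetRange using 3 with n z
    simp only [F]
    rw [derivs_zero]
    refine Finset.prod_congr rfl fun k _ => by ring
  have hd : ∀ j n, Differentiable ℂ (F j n) := fun j n z => (hasDerivAt_derivs _ _ n j z).differentiableAt
  have hT : ∀ j, TendstoLocallyUniformlyOn (F j) (deriv^[j] g) atTop Set.univ := by
    intro j
    induction j with
    | zero => exact h0
    | succ j ih =>
      have := ih.deriv (Eventually.of_forall fun n => (hd j n).differentiableOn) isOpen_univ
      rw [Function.iterate_succ_apply']
      convert this using 1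
      funext n z
      exact (hasDerivAt_derivs _ _ n j z).deriv.symm
  refine ⟨fun j x => (deriv^[j] g x).re, fun j x => ?_, fun j x => ?_⟩
  · have h1 : DifferentiableAt ℂ (deriv^[j] g) x :=
      ((hT j).differentiableOn (Eventually.of_forall fun n => (hd j n).differentiableOn)
        isOpen_univ).differentiableAt univ_mem
    simp only [Function.iterate_succ_apply']
    exact h1.hasDerivAt.real_of_complex
  · have := (Complex.continuous_re.tendsto _).comp ((hT j).tendsto_at (Set.mem_univ (x : ℂ)))
    refine this.congr fun n => ?_
    simp only [F, Function.comp, derivs_ofReal, Complex.ofReal_re]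


/-- `1/(q²;q²)_m`, extended by zero to negative `m`. -/
noncomputable def qR (q : ℝ) (m : ℤ) : ℝ :=
  if m < 0 then 0 else (∏ k ∈ Finset.range m.toNat, (1 - (q ^ 2) ^ (k + 1)))⁻¹

lemma hasSum_congr_aux {f g : ℤ → ℝ} {s : ℝ} (h : ∀ j, f j = g j) : HasSum f s ↔ HasSum g s := by
  rw [funext h]

section
variable {q : ℝ}

lemma one_sub_pos' (hq0 : 0 < q) (hq1 : q < 1) (k : ℕ) : 0 < 1 - (q ^ 2) ^ (k + 1) := by
  have : (q^2)^(k+1) < 1 := pow_lt_one₀ (by positivity) (by nlinarith) (by omega)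
  linarith

lemma qR_pred (hq0 : 0 < q) (hq1 : q < 1) (m : ℤ) :
    qR q (m - 1) = (1 - (q ^ 2) ^ m) * qR q m := by
  unfold qR
  rcases lt_trichotomy m 0 with h | h | h
  · rw [if_pos h, if_pos (by omega)]; simp
  · subst h; simp
  · obtain ⟨n, rfl⟩ : ∃ n : ℕ, m = n + 1 := ⟨(m-1).toNat, by omega⟩
    rw [if_neg (by omega), if_neg (by omega)]
    have e1 : ((n : ℤ) + 1 - 1).toNat = n := by omega
    have e2 : ((n : ℤ) + 1).toNat = n + 1 := by omega
    rw [e1, e2, Finset.prod_range_succ]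
    have h1 := (one_sub_pos' hq0 hq1 n).ne'
    have e3 : (q ^ 2) ^ ((n : ℤ) + 1) = (q^2)^(n+1) := by
      rw [← zpow_natCast (q^2) (n+1)]; push_cast; rfl
    rw [e3, mul_inv]
    field_simp

/-- Finite Jacobi coefficient (unnormalised). -/
noncomputable def qB (q : ℝ) (n : ℕ) (j : ℤ) : ℝ := q ^ (j ^ 2) * (qR q (n - j) * qR q (n + j))

lemma qB_rec (hq0 : 0 < q) (hq1 : q < 1) (n : ℕ) (j : ℤ) :
    (1 - (q^2)^(2*n+1)) * (1 - (q^2)^(2*n+2)) * qB q (n+1) j =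
      (1 + (q^(2*n+1))^2) * qB q n j + q^(2*n+1) * (qB q n (j-1) + qB q n (j+1)) := by
  have hq : q ≠ 0 := hq0.ne'
  unfold qB
  push_cast
  set A := qR q (n + 1 - j) with hA
  set B := qR q (n + 1 + j) with hB
  have a1 : qR q (n - j) = (1 - (q^2)^((n:ℤ) + 1 - j)) * A := by
    rw [hA, ← qR_pred hq0 hq1]; congr 1; ring
  have b1 : qR q (n + j) = (1 - (q^2)^((n:ℤ) + 1 + j)) * B := by
    rw [hB, ← qR_pred hq0 hq1]; congr 1; ring
  have a2 : qR q (n - (j+1)) = (1 - (q^2)^((n:ℤ) - j)) * ((1 - (q^2)^((n:ℤ) + 1 - j)) * A) := by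
    rw [← a1, ← qR_pred hq0 hq1]; congr 1; ring
  have b2 : qR q (n + (j-1)) = (1 - (q^2)^((n:ℤ) + j)) * ((1 - (q^2)^((n:ℤ) + 1 + j)) * B) := by
    rw [← b1, ← qR_pred hq0 hq1]; congr 1; ring
  have a3 : qR q (n - (j-1)) = A := by rw [hA]; congr 1; ring
  have b3 : qR q (n + (j+1)) = B := by rw [hB]; congr 1; ring
  rw [a1, b1, a2, b2, a3, b3]
  have e1 : q ^ ((j-1)^2) = q ^ (j^2) * (q^j)⁻¹ * (q^j)⁻¹ * q := by
    rw [← zpow_neg, ← zpow_add₀ hq, ← zpow_add₀ hq, ← zpow_add_one₀ hq]; congr 1; ring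
  have e2 : q ^ ((j+1)^2) = q ^ (j^2) * (q^j) * (q^j) * q := by
    rw [← zpow_add₀ hq, ← zpow_add₀ hq, ← zpow_add_one₀ hq]; congr 1; ring
  have hq2 : q^2 ≠ 0 := by positivity
  have e3 : (q^2)^j = q^j * q^j := by rw [← mul_zpow, pow_two]
  rw [e1, e2, zpow_sub₀ hq2, zpow_sub₀ hq2, zpow_add₀ hq2 _ j, zpow_add₀ hq2 _ j, zpow_add_one₀ hq2, e3,
    zpow_natCast]
  have hu : q ^ j ≠ 0 := zpow_ne_zero _ hq
  generalize q ^ j = u at *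
  generalize q ^ (j^2) = v at *
  have e4 : (q^2)^(2*n+1) = (q^n)^4 * q^2 := by ring
  have e5 : (q^2)^(2*n+2) = (q^n)^4 * q^4 := by ring
  have e6 : q^(2*n+1) = (q^n)^2*q := by ring
  have e7 : (q^2)^n = (q^n)^2 := by ring
  rw [e4, e5, e6, e7]
  generalize q ^ n = y
  field_simp
  ring

lemma finite_jacobi (hq0 : 0 < q) (hq1 : q < 1) (φ : ℝ) (n : ℕ) : ∀ α : ℝ,
    HasSum (fun j : ℤ => (∏ k ∈ Finset.range (2*n), (1 - (q ^ 2) ^ (k + 1))) * qB q n j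
      * Real.cos (j * φ + α))
      ((∏ k ∈ Finset.range n, ((1 + (q^(2*k+1))^2) + 2 * q^(2*k+1) * Real.cos φ)) * Real.cos α) := by
  induction n with
  | zero =>
    intro α
    have := hasSum_single (f := fun j : ℤ => (∏ k ∈ Finset.range (2*0), (1 - (q ^ 2) ^ (k + 1))) *
      qB q 0 j * Real.cos (j * φ + α)) 0 (by
        intro j hj
        have : qB q 0 j = 0 := by
          unfold qB qR
          rcases lt_or_gt_of_ne hj with h | h
          · rw [if_pos (show ((0:ℕ):ℤ) + j < 0 by simpa using h)]; simp
          · rw [if_pos (show ((0:ℕ):ℤ) - j < 0 by simpa using h)]; simp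
        simp [this])
    simpa [qB, qR] using this
  | succ n ih =>
    intro α
    set c := ∏ k ∈ Finset.range (2*n), (1 - (q ^ 2) ^ (k + 1)) with hc
    have e : ∏ k ∈ Finset.range (2*(n+1)), (1 - (q ^ 2) ^ (k + 1)) =
        c * ((1 - (q^2)^(2*n+1)) * (1 - (q^2)^(2*n+2))) := by
      rw [show 2*(n+1) = 2*n+1+1 by ring, Finset.prod_range_succ, Finset.prod_range_succ, hc]
      ring
    rw [e, Finset.prod_range_succ]
    set P := ∏ k ∈ Finset.range n, ((1 + (q^(2*k+1))^2) + 2 * q^(2*k+1) * Real.cos φ) with hP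
    have k1 : HasSum (fun j : ℤ => c * qB q n (j-1) * Real.cos (j * φ + α))
        (P * Real.cos (α + φ)) := by
      have := (Equiv.addRight (-1 : ℤ)).hasSum_iff.mpr (ih (α + φ))
      refine (hasSum_congr_aux fun j => ?_).mp this
      simp only [Function.comp, Equiv.coe_addRight]
      rw [← sub_eq_add_neg]
      push_cast
      congr 2; ring
    have k2 : HasSum (fun j : ℤ => c * qB q n (j+1) * Real.cos (j * φ + α))
        (P * Real.cos (α - φ)) := by
      have := (Equiv.addRight (1 : ℤ)).hasSum_iff.mpr (ih (α - φ))
      refine (hasSum_congr_aux fun j => ?_).mp this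
      simp only [Function.comp, Equiv.coe_addRight]
      push_cast
      congr 2; ring
    have := ((ih α).mul_left (1 + (q^(2*n+1))^2)).add ((k1.add k2).mul_left (q^(2*n+1)))
    have e2 : (1 + (q^(2*n+1))^2) * (P * Real.cos α) +
        q^(2*n+1) * (P * Real.cos (α + φ) + P * Real.cos (α - φ)) =
        P * (1 + (q^(2*n+1))^2 + 2 * q^(2*n+1) * Real.cos φ) * Real.cos α := by
      rw [Real.cos_add, Real.cos_sub]; ring
    rw [e2] at this
    refine (hasSum_congr_aux fun j => ?_).mp this
    have := qB_rec hq0 hq1 n j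
    linear_combination (-c * Real.cos (j * φ + α)) * this

open Filter Topology

lemma qprod_tendsto (hq0 : 0 < q) (hq1 : q < 1) : ∃ L : ℝ, 0 < L ∧
    (∀ m, L ≤ ∏ k ∈ Finset.range m, (1 - (q ^ 2) ^ (k + 1))) ∧
    Tendsto (fun m => ∏ k ∈ Finset.range m, (1 - (q ^ 2) ^ (k + 1))) atTop (𝓝 L) := by
  have hs : Summable fun k : ℕ => ‖-(q^2)^(k+1)‖ := by
    have : Summable fun k : ℕ => (q^2)^k :=
      summable_geometric_of_lt_one (by positivity) (by nlinarith)
    refine ((summable_nat_add_iff 1).mpr this).congr fun k => ?_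
    rw [norm_neg, Real.norm_of_nonneg (by positivity)]
  have hne : ∏' k : ℕ, (1 + -(q^2)^(k+1)) ≠ 0 :=
    tprod_one_add_ne_zero_of_summable (fun k => by
      have := one_sub_pos' hq0 hq1 k
      rw [← sub_eq_add_neg]; exact this.ne') hs
  have ht : Tendsto (fun m => ∏ k ∈ Finset.range m, (1 - (q ^ 2) ^ (k + 1))) atTop
      (𝓝 (∏' k : ℕ, (1 + -(q^2)^(k+1)))) := by
    simpa [sub_eq_add_neg] using (multipliable_one_add_of_summable hs).hasProd.tendsto_prod_nat
  have hpos : ∀ m, 0 < ∏ k ∈ Finset.range m, (1 - (q ^ 2) ^ (k + 1)) := fun m =>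
    Finset.prod_pos fun k _ => one_sub_pos' hq0 hq1 k
  have hanti : Antitone (fun m => ∏ k ∈ Finset.range m, (1 - (q ^ 2) ^ (k + 1))) := by
    refine antitone_nat_of_succ_le fun m => ?_
    rw [Finset.prod_range_succ]
    have : 0 ≤ (q^2)^(m+1) := by positivity
    have := hpos m
    nlinarith
  refine ⟨_, lt_of_le_of_ne (ge_of_tendsto' ht fun m => (hpos m).le) hne.symm,
    fun m => hanti.le_of_tendsto ht m, ht⟩

lemma jacobi_limit (hq0 : 0 < q) (hq1 : q < 1) (hsum : Summable fun j : ℤ => q ^ (j^2)) :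
    ∃ L : ℝ, 0 < L ∧ ∀ φ : ℝ,
    Tendsto (fun n => ∏ k ∈ Finset.range n, ((1 + (q^(2*k+1))^2) + 2 * q^(2*k+1) * Real.cos φ))
      atTop (𝓝 (L * ∑' j : ℤ, q ^ (j^2) * Real.cos (j * φ))) := by
  obtain ⟨L, hL, hLle, hLt⟩ := qprod_tendsto hq0 hq1
  refine ⟨L⁻¹, by positivity, fun φ => ?_⟩
  have hR0 : ∀ m, 0 ≤ qR q m := by
    intro m; unfold qR; split_ifs
    · exact le_rfl
    · exact inv_nonneg.mpr (hL.le.trans (hLle _))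
  have hR1 : ∀ m, qR q m ≤ L⁻¹ := by
    intro m; unfold qR; split_ifs
    · positivity
    · exact inv_anti₀ hL (hLle _)
  have hRt : Tendsto (fun n : ℕ => qR q n) atTop (𝓝 L⁻¹) := by
    refine (hLt.inv₀ hL.ne').congr fun n => ?_
    simp [qR]
  have hRj : ∀ j : ℤ, Tendsto (fun n : ℕ => qR q (n + j)) atTop (𝓝 L⁻¹) := by
    intro j
    have h1 : Tendsto (fun n : ℕ => ((n : ℤ) + j).toNat) atTop atTop := by
      refine tendsto_atTop.mpr fun b => ?_
      filter_upwards [eventually_ge_atTop (b + j.natAbs)] with n hn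
      omega
    refine (hRt.comp h1).congr' ?_
    filter_upwards [eventually_ge_atTop j.natAbs] with n hn
    simp only [Function.comp]
    congr 1; omega
  have hc1 : ∀ n, ∏ k ∈ Finset.range (2*n), (1 - (q ^ 2) ^ (k + 1)) ≤ 1 := fun n =>
    Finset.prod_le_one (fun k _ => (one_sub_pos' hq0 hq1 k).le) fun k _ => by
      have : 0 ≤ (q^2)^(k+1) := by positivity
      linarith
  have hct : Tendsto (fun n => ∏ k ∈ Finset.range (2*n), (1 - (q ^ 2) ^ (k + 1))) atTop (𝓝 L) :=
    hLt.comp (tendsto_id.const_mul_atTop' (by norm_num))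
  have e : ∀ n, ∏ k ∈ Finset.range n, ((1 + (q^(2*k+1))^2) + 2 * q^(2*k+1) * Real.cos φ) =
      ∑' j : ℤ, (∏ k ∈ Finset.range (2*n), (1 - (q ^ 2) ^ (k + 1))) * qB q n j
      * Real.cos (j * φ) := by
    intro n
    have := (finite_jacobi hq0 hq1 φ n 0).tsum_eq
    simpa using this.symm
  simp_rw [e]
  rw [← tsum_mul_left]
  refine tendsto_tsum_of_dominated_convergence (bound := fun j : ℤ => q^(j^2) * (L⁻¹ * L⁻¹))
    (hsum.mul_right _) (fun j => ?_) (Eventually.of_forall fun n j => ?_)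
  · have h1 := (hct.mul ((hRj (-j)).mul (hRj j))).mul_const (q^(j^2) * Real.cos (j * φ))
    have : L * (L⁻¹ * L⁻¹) * (q^(j^2) * Real.cos (j * φ)) = L⁻¹ * (q^(j^2) * Real.cos (j * φ)) := by
      field_simp
    rw [this] at h1
    refine h1.congr fun n => ?_
    rw [qB, ← sub_eq_add_neg]; ring
  · rw [norm_mul, Real.norm_eq_abs, Real.norm_eq_abs]
    have hq' : 0 ≤ q^(j^2) := by positivity
    have hB : 0 ≤ qB q n j := mul_nonneg hq' (mul_nonneg (hR0 _) (hR0 _))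
    have hc0 := hL.le.trans (hLle (2*n))
    have hB1 : qB q n j ≤ q^(j^2) * (L⁻¹ * L⁻¹) := by
      unfold qB
      have := hR0 (n - j)
      have := hR0 (n + j)
      have := hR1 (n - j)
      have := hR1 (n + j)
      gcongr
    rw [abs_of_nonneg (mul_nonneg hc0 hB)]
    calc _ ≤ 1 * qB q n j * 1 := by
          gcongr
          · exact hc1 n
          · exact Real.abs_cos_le_one _
      _ ≤ _ := by simpa using hB1
end

lemma qpow_eq (t : ℝ) (j : ℤ) : (Real.exp (-t)) ^ (j^2) = Real.exp (-t * (j:ℝ)^2) := by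
  rw [← Real.rpow_intCast, ← Real.exp_mul]; push_cast; rfl

lemma summable_gauss {t : ℝ} (ht : 0 < t) : Summable fun j : ℤ => Real.exp (-t * (j:ℝ)^2) := by
  have := summable_pow_mul_jacobiTheta₂_term_bound 0 (T := t / Real.pi) (by positivity) 0
  refine this.congr fun j => ?_
  have := Real.pi_pos.ne'
  rw [pow_zero, one_mul]
  congr 1
  field_simp
  ring

lemma theta_poisson {t : ℝ} (ht : 0 < t) : ∃ κ : ℝ, 0 < κ ∧ ∀ φ,
    theta t φ = κ * ∑' j : ℤ, (Real.exp (-t)) ^ (j^2) * Real.cos (j * φ) := by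
  have hpi := Real.pi_pos
  have ha : 0 < t / Real.pi := by positivity
  refine ⟨1 / Real.sqrt (4 * Real.pi * t) * (t / Real.pi) ^ (1/2 : ℝ), by positivity, fun φ => ?_⟩
  have h := Complex.tsum_exp_neg_quadratic (a := ((t / Real.pi : ℝ) : ℂ))
    (by rwa [Complex.ofReal_re]) (((-φ / (2 * Real.pi) : ℝ) : ℂ) * Complex.I)
  have hpc : (Real.pi : ℂ) ≠ 0 := by exact_mod_cast hpi.ne'
  have htc : (t : ℂ) ≠ 0 := by exact_mod_cast ht.ne'
  have e1 : ∀ n : ℤ, Complex.exp (-(Real.pi : ℂ) * ((t / Real.pi : ℝ) : ℂ) * (n : ℂ) ^ 2 +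
      2 * Real.pi * (((-φ / (2 * Real.pi) : ℝ) : ℂ) * Complex.I) * n) =
      ((Real.exp (-t * (n:ℝ)^2) : ℝ) : ℂ) * Complex.exp (((-(n * φ) : ℝ) : ℂ) * Complex.I) := by
    intro n
    rw [Complex.ofReal_exp, ← Complex.exp_add]
    congr 1
    push_cast
    field_simp
  have e2 : ∀ n : ℤ, Complex.exp (-(Real.pi : ℂ) / ((t / Real.pi : ℝ) : ℂ) *
      ((n : ℂ) + Complex.I * (((-φ / (2 * Real.pi) : ℝ) : ℂ) * Complex.I)) ^ 2) =
      ((Real.exp (-(φ + 2 * Real.pi * n) ^ 2 / (4 * t)) : ℝ) : ℂ) := by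
    intro n
    rw [Complex.ofReal_exp]
    congr 1
    have : Complex.I * (((-φ / (2 * Real.pi) : ℝ) : ℂ) * Complex.I) =
        ((φ / (2 * Real.pi) : ℝ) : ℂ) := by
      push_cast
      linear_combination (-(φ:ℂ) / (2 * Real.pi)) * Complex.I_mul_I
    rw [this]
    push_cast
    field_simp
    ring
  simp_rw [e1, e2] at h
  rw [← Complex.ofReal_tsum, show (1 / 2 : ℂ) = ((1/2 : ℝ) : ℂ) by push_cast; rfl,
    ← Complex.ofReal_cpow ha.le] at h
  have hs : Summable fun n : ℤ => ((Real.exp (-t * (n:ℝ)^2) : ℝ) : ℂ) *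
      Complex.exp (((-(n * φ) : ℝ) : ℂ) * Complex.I) := by
    refine Summable.of_norm ((summable_gauss ht).congr fun n => ?_)
    rw [norm_mul, Complex.norm_exp_ofReal_mul_I, mul_one, Complex.norm_real,
      Real.norm_of_nonneg (Real.exp_pos _).le]
  have h' := congrArg Complex.re h
  rw [Complex.re_tsum hs] at h'
  have e3 : ∀ n : ℤ, (((Real.exp (-t * (n:ℝ)^2) : ℝ) : ℂ) *
      Complex.exp (((-(n * φ) : ℝ) : ℂ) * Complex.I)).re =
      (Real.exp (-t)) ^ (n^2) * Real.cos (n * φ) := by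
    intro n
    rw [Complex.re_ofReal_mul, Complex.exp_ofReal_mul_I_re, Real.cos_neg, qpow_eq]
  simp_rw [e3] at h'
  rw [h']
  have e4 : ∀ r s : ℝ, ((1 : ℂ) / (r : ℂ) * (s : ℂ)).re = 1 / r * s := by
    intro r s
    rw [← Complex.ofReal_one, ← Complex.ofReal_div, ← Complex.ofReal_mul, Complex.ofReal_re]
  rw [e4]
  unfold theta W
  rw [tsum_mul_left]
  have : (t / Real.pi) ^ (1/2 : ℝ) ≠ 0 := by positivity
  field_simp

lemma W_pos {t : ℝ} (ht : 0 < t) (x : ℝ) : 0 < W t x := by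
  have := Real.pi_pos
  unfold W; positivity

lemma W_shift_le {t φ : ℝ} (ht : 0 < t) (ht1 : t ≤ 1) (h0 : 0 < φ) (h1 : φ < Real.pi) (n : ℤ) :
    W t (φ + 2 * Real.pi * n) ≤ W t φ * Real.exp (-Real.pi * (1 * n ^ 2 - 2 * (1/2) * |n|)) := by
  have hpi := Real.pi_pos
  unfold W
  rw [mul_assoc (1 / _), ← Real.exp_add]
  gcongr
  have hn : 0 ≤ (n:ℝ)^2 - |(n:ℝ)| := by
    have : |n| ≤ n^2 := by
      rcases eq_or_ne n 0 with rfl | h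
      · simp
      · have := Int.one_le_abs h
        rw [← sq_abs]; nlinarith
    have : ((|n| : ℤ) : ℝ) ≤ ((n^2 : ℤ) : ℝ) := by exact_mod_cast this
    push_cast at this; linarith
  have h2 : -(Real.pi * |(n:ℝ)|) ≤ n * φ := by
    have := neg_abs_le ((n:ℝ) * φ)
    rw [abs_mul, abs_of_pos h0] at this
    have : |(n:ℝ)| * φ ≤ |(n:ℝ)| * Real.pi := by gcongr
    linarith
  have e : -(φ + 2 * Real.pi * n) ^ 2 / (4 * t) = -φ^2/(4*t) - Real.pi * (n * φ + Real.pi * n^2) / t := by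
    field_simp; ring
  rw [e]
  have h3 : Real.pi * (n^2 - |(n:ℝ)|) ≤ n * φ + Real.pi * n^2 := by linarith
  have h4 : Real.pi * (n^2 - |(n:ℝ)|) ≤ Real.pi * (n * φ + Real.pi * n^2) / t := by
    rw [le_div_iff₀ ht]
    have h5 : 0 ≤ Real.pi * ((n:ℝ)^2 - |(n:ℝ)|) := by positivity
    have := Real.pi_gt_three
    nlinarith
  push_cast
  linarith

lemma theta_bounds : ∃ K : ℝ, 0 < K ∧ ∀ t φ : ℝ, 0 < t → t ≤ 1 → 0 < φ → φ < Real.pi →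
    W t φ ≤ theta t φ ∧ theta t φ ≤ K * W t φ := by
  have hs := summable_pow_mul_jacobiTheta₂_term_bound (1/2) (T := 1) one_pos 0
  simp only [pow_zero, one_mul] at hs
  refine ⟨∑' n : ℤ, Real.exp (-Real.pi * (1 * n ^ 2 - 2 * (1/2) * |n|)), ?_, ?_⟩
  · simp only [one_mul]
    exact hs.tsum_pos (fun _ => (Real.exp_pos _).le) 0 (Real.exp_pos _)
  · intro t φ ht ht1 h0 h1
    have hs2 := hs.mul_left (W t φ)
    have hle := W_shift_le ht ht1 h0 h1
    simp only [one_mul] at hle ⊢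
    have hs3 : Summable fun n : ℤ => W t (φ + 2 * Real.pi * n) :=
      Summable.of_nonneg_of_le (fun n => (W_pos ht _).le) hle hs2
    constructor
    · have := hs3.le_tsum 0 (fun n _ => (W_pos ht _).le)
      simpa [theta] using this
    · rw [mul_comm, ← tsum_mul_left]
      exact hs3.tsum_le_tsum hle hs2

open Filter Topology

lemma negD_iter_eq (t A : ℝ) (G : ℕ → ℝ → ℝ) (hG : ∀ j x, HasDerivAt (G j) (G (j + 1) x) x)
    (h0 : ∀ φ, theta t φ = A * G 0 (Real.cos φ)) (N : ℕ) :
    ∀ φ ∈ Set.Ioo 0 Real.pi, (negD^[N] (theta t)) φ = A * G N (Real.cos φ) := by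
  induction N with
  | zero => intro φ _; exact h0 φ
  | succ N ih =>
    intro φ hφ
    rw [Function.iterate_succ_apply']
    have he : negD^[N] (theta t) =ᶠ[𝓝 φ] fun φ => A * G N (Real.cos φ) := by
      filter_upwards [isOpen_Ioo.mem_nhds hφ] with ψ hψ using ih ψ hψ
    have hd : HasDerivAt (fun φ => A * G N (Real.cos φ))
        (A * (G (N+1) (Real.cos φ) * -Real.sin φ)) φ :=
      ((hG N (Real.cos φ)).comp φ (Real.hasDerivAt_cos φ)).const_mul A
    have hs : Real.sin φ ≠ 0 := (Real.sin_pos_of_mem_Ioo hφ).ne'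
    simp only [negD]
    rw [he.deriv_eq, hd.deriv]
    field_simp

lemma factor_eq (t : ℝ) (k : ℕ) (x : ℝ) :
    (1 + (Real.exp (-t) ^ (2*k+1))^2) + 2 * Real.exp (-t) ^ (2*k+1) * x =
      2 * Real.exp (-t) ^ (2*k+1) * (Real.cosh ((2*k+1) * t) + x) := by
  have e : Real.exp (-t) ^ (2*k+1) = Real.exp (-((2*k+1) * t)) := by
    rw [← Real.exp_nat_mul]; congr 1; push_cast; ring
  rw [e, Real.cosh_eq]
  have : Real.exp ((2*k+1) * t) * Real.exp (-((2*k+1) * t)) = 1 := by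
    rw [← Real.exp_add]; simp
  linear_combination -this

lemma cosh_ge (y : ℝ) : 1 + y^2/2 ≤ Real.cosh y := by
  have h1 : Real.cosh y = 1 + 2 * Real.sinh (y/2)^2 := by
    have := Real.cosh_two_mul (y/2)
    rw [show 2 * (y/2) = y by ring, Real.cosh_sq] at this
    linarith
  have h2 : (y/2)^2 ≤ Real.sinh (y/2)^2 := by
    rw [sq_le_sq, Real.abs_sinh]
    exact Real.self_le_sinh_iff.mpr (abs_nonneg _)
  rw [h1]; nlinarith

lemma cosh_le {y : ℝ} (h0 : 0 ≤ y) (h1 : y ≤ 1) : Real.cosh y ≤ 1 + y^2 := by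
  have h2 : y^2 ≤ 1 := by nlinarith
  have h3 : 0 ≤ y^2 := by positivity
  have h4 := Real.add_one_le_exp (-(y^2/2))
  have h5 : Real.exp (y^2/2) * Real.exp (-(y^2/2)) = 1 := by rw [← Real.exp_add]; simp
  have h6 := Real.exp_pos (y^2/2)
  have h7 : Real.exp (y^2/2) * (1 - y^2/2) ≤ 1 := by nlinarith
  refine (Real.cosh_le_exp_half_sq y).trans ?_
  nlinarith

theorem negD_iter_theta_sharp_estimate_near_antipode (N : ℕ) :
    ∀ M₀ : ℝ, 0 < M₀ → ∃ t₀ : ℝ, 0 < t₀ ∧ ∃ c C : ℝ, 0 < c ∧ 0 < C ∧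
      ∀ φ t : ℝ, φ ∈ Set.Ioo 0 Real.pi → 0 < t → t ≤ t₀ →
        (Real.pi - φ) / t ≤ M₀ →
        c * W t φ * t ^ (-(2 * (N : ℝ))) ≤ (negD^[N] (theta t)) φ ∧
        (negD^[N] (theta t)) φ ≤ C * W t φ * t ^ (-(2 * (N : ℝ))) := by
  intro M₀ hM
  obtain ⟨K, hK, hθ⟩ := theta_bounds
  have hsq : Summable fun k : ℕ => 1 / ((k : ℝ) + 1)^2 := by
    have := (summable_nat_add_iff 1).mpr (Real.summable_one_div_nat_pow.mpr one_lt_two)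
    simpa using this
  set Z := ∑' k : ℕ, 1 / ((k : ℝ) + 1)^2 with hZ
  have hZ0 : 0 < Z := hsq.tsum_pos (fun k => by positivity) 0 (by norm_num)
  set Q : ℝ := (2*N+1)^2 + M₀^2 with hQ
  have hQ0 : 0 < Q := by positivity
  refine ⟨1 / (2*N+1), by positivity, Q⁻¹ ^ N, K * (2 * Z)^N, by positivity, by positivity, ?_⟩
  intro φ t hφ ht ht0 hφt
  have hNt : (2*N+1) * t ≤ 1 := by
    rw [le_div_iff₀ (by positivity)] at ht0; linarith
  have ht1 : t ≤ 1 := by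
    have : 0 ≤ (N:ℝ) * t := by positivity
    nlinarith
  obtain ⟨hθ1, hθ2⟩ := hθ t φ ht ht1 hφ.1 hφ.2
  have hpow : t ^ (-(2 * (N : ℝ))) = (t^2)⁻¹ ^ N := by
    rw [Real.rpow_neg ht.le, inv_pow, ← pow_mul, ← Real.rpow_natCast]; push_cast; rfl
  rw [hpow]
  set q := Real.exp (-t) with hq
  have hq0 : 0 < q := Real.exp_pos _
  have hq1 : q < 1 := by
    rw [hq, ← Real.exp_zero]; exact Real.exp_lt_exp.mpr (by linarith)
  set a : ℕ → ℝ := fun k => 1 + (q^(2*k+1))^2 with ha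
  set b : ℕ → ℝ := fun k => 2 * q^(2*k+1) with hb
  have hb0 : ∀ k, 0 < b k := fun k => by positivity
  have hgeo : Summable fun k : ℕ => q^k := summable_geometric_of_lt_one hq0.le hq1
  have hbs : Summable fun k => |b k| := by
    refine Summable.of_nonneg_of_le (fun k => abs_nonneg _) (fun k => ?_) (hgeo.mul_left 2)
    rw [abs_of_pos (hb0 k)]
    have : q^(2*k+1) ≤ q^k := pow_le_pow_of_le_one hq0.le hq1.le (by omega)
    simp only [hb]; linarith
  have has : Summable fun k => |a k - 1| := by
    refine Summable.of_nonneg_of_le (fun k => abs_nonneg _) (fun k => ?_) hgeo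
    have : (q^(2*k+1))^2 ≤ q^k := by
      rw [← pow_mul]; exact pow_le_pow_of_le_one hq0.le hq1.le (by omega)
    simp only [ha, add_sub_cancel_left]
    rwa [abs_of_nonneg (by positivity)]
  obtain ⟨G, hG, hGt⟩ := exists_limit a b has hbs
  obtain ⟨L, hL, hLt⟩ := jacobi_limit hq0 hq1 ((summable_gauss ht).congr fun j => (qpow_eq t j).symm)
  obtain ⟨κ, hκ, hκθ⟩ := theta_poisson ht
  have hG0 : ∀ ψ, theta t ψ = (κ * L⁻¹) * G 0 (Real.cos ψ) := by
    intro ψ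
    have h1 := hGt 0 (Real.cos ψ)
    simp_rw [derivs_zero] at h1
    rw [tendsto_nhds_unique h1 (hLt ψ), hκθ ψ, ← hq]
    rw [mul_assoc, inv_mul_cancel_left₀ hL.ne']
  rw [negD_iter_eq t _ G hG hG0 N φ hφ]
  have hA : 0 < κ * L⁻¹ := by positivity
  set x := Real.cos φ with hx
  have hx1 : -1 ≤ x := Real.neg_one_le_cos φ
  have hfac : ∀ k, a k + b k * x = b k * (Real.cosh ((2*k+1) * t) + x) := fun k => factor_eq t k x
  have hcosh : ∀ k : ℕ, ((k+1)*t)^2/2 ≤ Real.cosh ((2*k+1) * t) + x := by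
    intro k
    have h1 := cosh_ge ((2*k+1) * t)
    have h2 : ((k+1)*t)^2 ≤ ((2*k+1) * t)^2 := by
      gcongr
      have : (0:ℝ) ≤ k := by positivity
      linarith
    linarith
  have hl : ∀ k, 0 < a k + b k * x := by
    intro k
    rw [hfac]
    exact mul_pos (hb0 k) (lt_of_lt_of_le (by positivity) (hcosh k))
  have hlow : ∀ n ≥ N, ((Q * t^2)⁻¹)^N * derivs a b n 0 x ≤ derivs a b n N x := by
    intro n hn
    refine derivs_lower a b x (fun k => (hb0 k).le) hl _ (by positivity) N (fun k hk => ?_) n N hn le_rfl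
    rw [hfac]
    have hk' : (k:ℝ) + 1 ≤ N := by exact_mod_cast hk
    have hy : (2*k+1) * t ≤ (2*N+1) * t := by gcongr
    have h1 := cosh_le (y := (2*k+1) * t) (by positivity) (by linarith)
    have h1' : ((2*k+1) * t)^2 ≤ ((2*N+1) * t)^2 := by gcongr
    have h2 : x ≤ -1 + (M₀ * t)^2/2 := by
      have h3 := Real.one_sub_sq_div_two_le_cos (x := Real.pi - φ)
      rw [Real.cos_pi_sub] at h3
      have h4 : Real.pi - φ ≤ M₀ * t := (div_le_iff₀ ht).mp hφt
      have h5 : (Real.pi - φ)^2 ≤ (M₀ * t)^2 := by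
        have h7 := hφ.2
        have h8 : 0 ≤ Real.pi - φ := by linarith
        gcongr
      linarith
    have h6 : Real.cosh ((2*k+1) * t) + x ≤ Q * t^2 := by
      have : 0 ≤ (M₀ * t)^2 := by positivity
      rw [hQ]; nlinarith
    calc _ ≤ (Q * t^2)⁻¹ * (b k * (Q * t^2)) := by
          have := hb0 k
          gcongr
      _ = b k := by field_simp
  have hup : ∀ n, derivs a b n N x ≤ (2 * Z * (t^2)⁻¹)^N * derivs a b n 0 x := by
    intro n
    refine (derivs_upper a b x (fun k => (hb0 k).le) hl
      (fun k => 2 * (t^2)⁻¹ * (1 / ((k:ℝ)+1)^2)) (fun k => by positivity) (fun k => ?_) n N).trans ?_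
    · rw [hfac]
      have h1 := hcosh k
      calc b k = 2 * (t^2)⁻¹ * (1 / ((k:ℝ)+1)^2) * (b k * (((k+1)*t)^2/2)) := by field_simp
        _ ≤ _ := by
          have := hb0 k
          gcongr
    · have h0 := derivs_nonneg a b x (fun k => (hb0 k).le) hl n 0
      gcongr
      rw [← Finset.mul_sum]
      have : ∑ k ∈ Finset.range n, 1 / ((k:ℝ)+1)^2 ≤ Z :=
        hsq.sum_le_tsum _ (fun k _ => by positivity)
      calc _ ≤ 2 * (t^2)⁻¹ * Z := by gcongr
        _ = _ := by ring
  have hlow' : ((Q * t^2)⁻¹)^N * G 0 x ≤ G N x :=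
    le_of_tendsto_of_tendsto ((hGt 0 x).const_mul _) (hGt N x)
      (by filter_upwards [eventually_ge_atTop N] with n hn using hlow n hn)
  have hup' : G N x ≤ (2 * Z * (t^2)⁻¹)^N * G 0 x :=
    le_of_tendsto_of_tendsto (hGt N x) ((hGt 0 x).const_mul _)
      (Eventually.of_forall hup)
  have hth := hG0 φ
  rw [← hx] at hth
  constructor
  · calc _ = ((Q * t^2)⁻¹)^N * W t φ := by rw [mul_inv, mul_pow]; ring
      _ ≤ ((Q * t^2)⁻¹)^N * theta t φ := by gcongr
      _ = κ * L⁻¹ * (((Q * t^2)⁻¹)^N * G 0 x) := by rw [hth]; ring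
      _ ≤ _ := by gcongr
  · calc _ ≤ κ * L⁻¹ * ((2 * Z * (t^2)⁻¹)^N * G 0 x) := by gcongr
      _ = (2 * Z * (t^2)⁻¹)^N * theta t φ := by rw [hth]; ring
      _ ≤ (2 * Z * (t^2)⁻¹)^N * (K * W t φ) := by gcongr
      _ = _ := by rw [mul_pow]; ring
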